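/- (Lemma 1(iv)) If f is a blocking flow in a rooted tree instance I(e), then every edge e' ∈ E_e with f(e') = c(e') satisfies c(e') ∈ Ψ(e'). -/

import Mathlib

open Classical

/-- `⟨a,b⟩`: the set `{a, a+2, …, b}` of consecutive odd or even integers. -/
def Iv (a b : ℕ) : Set ℕ := {x | a ≤ x ∧ x ≤ b ∧ x % 2 = a % 2}

/-- `A ⊗ B = {a + b − 2i : a ∈ A, b ∈ B, 0 ≤ i ≤ min(a,b)}`. -/
def otimes (A B : Set ℕ) : Set ℕ :=
  {x | ∃ a ∈ A, ∃ b ∈ B, ∃ i, i ≤ min a b ∧ x = a + b - 2 * i}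

/-- A tree instance `(G,T,c)` rooted at a terminal `r`: a tree on vertex set `V`,
encoded by the parent function `par` (with `par root = root`) together with a depth
function certifying acyclicity.  Each non-root vertex `v` is identified with the edge
`(par v, v)`; `c v` is the (positive integer) capacity of that edge.  The terminals are
the leaves; the root has exactly one child and every internal vertex has exactly
two children (total degree 3). -/
structure RTI (V : Type*) where
  root : V
  par : V → V
  dep : V → ℕ
  c : V → ℕ
  par_root : par root = root
  dep_root : dep root = 0
  dep_par : ∀ v, v ≠ root → dep v = dep (par v) + 1
  cap_pos : ∀ v, v ≠ root → 1 ≤ c v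
  root_degree : {w : V | par w = root ∧ w ≠ root}.ncard = 1
  internal_degree : ∀ v, v ≠ root → {w : V | par w = v ∧ w ≠ root}.Nonempty →
    {w : V | par w = v ∧ w ≠ root}.ncard = 2

namespace RTI

variable {V : Type*} (R : RTI V)

/-- `R.below u v`: `v` lies in the subtree rooted at `u` (i.e. `u` is an ancestor of
`v`, allowing `u = v`). -/
def below (u v : V) : Prop :=
  Relation.ReflTransGen (fun a b => R.par b = a ∧ b ≠ R.root) u v

/-- `v` is a leaf of the tree other than the root. -/
def leaf (v : V) : Prop := v ≠ R.root ∧ ∀ w, w ≠ R.root → R.par w ≠ v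

/-- The children of `v` (as lower endpoints of child-edges). -/
def children (v : V) : Set V := {w | R.par w = v ∧ w ≠ R.root}

/-- For an edge `e = (par v, v)`, the vertex set `V_e` of the instance `I(e)`. -/
def Ve (v : V) : Set V := insert (R.par v) {w | R.below v w}

/-- `T_e`: the terminals of `I(e)` other than `u = par v`. -/
def Te (v : V) : Set V := {w | R.below v w ∧ R.leaf w}

/-- The full terminal set `T_e ∪ {u}` of the instance `I(e)`. -/
def S (v : V) : Set V := insert (R.par v) (R.Te v)

/-- The edge `(par x, x)` lies on the tree path between `t` and `t'`
(exactly one of `t, t'` is in the subtree below `x`). -/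
def onPath (x t t' : V) : Prop :=
  (R.below x t ∧ ¬ R.below x t') ∨ (¬ R.below x t ∧ R.below x t')

/-- The vertex `x` lies on the tree path between `t` and `t'`. -/
def onPathV (x t t' : V) : Prop :=
  (R.below x t ∨ R.below x t') ∧ ∀ z, R.below z t → R.below z t' → R.below z x

/-- Unordered pairs of distinct terminals of the instance `I(e)` for `e = (par v, v)`. -/
def PathPairs (v : V) : Set (Sym2 V) :=
  {p | ∃ t t', t ∈ R.S v ∧ t' ∈ R.S v ∧ t ≠ t' ∧ p = s(t, t')}

/-- `g` is a decomposition of `f` in the instance `I(e)`, `e = (par v, v)`: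
`g` is supported on pairs of distinct terminals and, on every edge of `I(e)`,
`f` is the sum of `g` over the (unique) terminal-pair paths through that edge. -/
def IsDecomp (v : V) (f : V → ℕ) (g : Sym2 V → ℕ) : Prop :=
  (∀ p, g p ≠ 0 → p ∈ R.PathPairs v) ∧
  ∀ w, R.below v w →
    f w = ∑ᶠ p ∈ {p : Sym2 V | ∃ t t', p = s(t, t') ∧ R.onPath w t t'}, g p

/-- `f` is an (integral) flow in the instance `I(e)`, `e = (par v, v)`. -/
def IsFlow (v : V) (f : V → ℕ) : Prop := ∃ g, R.IsDecomp v f g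

/-- `f` is feasible in `I(e)`. -/
def Feasible (v : V) (f : V → ℕ) : Prop := ∀ w, R.below v w → f w ≤ R.c w

/-- `V_f(s)`: the set of vertices `w` of `I(e)` reachable from `s` by travelling
upward along edges with `c − f ≥ 1` to a common ancestor and then downward along
edges with `c − f ≥ 2`. -/
def Vf (v : V) (f : V → ℕ) (s : V) : Set V :=
  {w | w ∈ R.Ve v ∧ ∃ z ∈ R.Ve v, R.below z s ∧ R.below z w ∧
    (∀ x, R.below z x → R.below x s → x ≠ z → f x + 1 ≤ R.c x) ∧
    (∀ x, R.below z x → R.below x w → x ≠ z → f x + 2 ≤ R.c x)}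

/-- `W` induces a connected subgraph of the tree (it is closed under tree paths). -/
def ConnSet (W : Set V) : Prop :=
  ∀ w₁ ∈ W, ∀ w₂ ∈ W, ∀ x, R.onPathV x w₁ w₂ → x ∈ W

/-- `E(X)` inside the instance `I(e)`, `e = (par v, v)`: the edges `(par x, x)` of
`I(e)` with exactly one endpoint in `X`. -/
def cutE (v : V) (X : Set V) : Set V :=
  {x | R.below v x ∧ ¬ (x ∈ X ↔ R.par x ∈ X)}

/-- `h(X) = Σ_{e' ∈ E(X)} h(e')` inside the instance `I(e)`, `e = (par v, v)`. -/
noncomputable def hval (v : V) (X : Set V) (h : V → ℕ) : ℕ := ∑ᶠ x ∈ R.cutE v X, h x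

/-- `W` is a connected component of the subgraph of `I(e)` induced by `A`. -/
def IsComp (v : V) (A W : Set V) : Prop :=
  W.Nonempty ∧ W ⊆ A ∧ R.ConnSet W ∧
  (∀ x, R.below v x → x ∈ W → R.par x ∈ A → R.par x ∈ W) ∧
  (∀ x, R.below v x → R.par x ∈ W → x ∈ A → x ∈ W)

/-- `odd(X)` (relative to the union `U` of the removed terminal sets): the components
`W` of `G_e − U` with `c(W)` odd whose parent-edge is a child-edge of `X`. -/
def oddOf (v : V) (U X : Set V) : Set (Set V) :=
  {W | R.IsComp v (R.Ve v \ U) W ∧ Odd (R.hval v W R.c) ∧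
    ∃ y ∈ W, R.par y ∉ W ∧ R.par y ∈ X}

/-- The union of the sets `V_f(t)`, `t ∈ T_e`. -/
def UT (v : V) (f : V → ℕ) : Set V := ⋃ t ∈ R.Te v, R.Vf v f t

/-- The union of the sets `V_f(t)`, `t ∈ T_e ∪ {u}`. -/
def USall (v : V) (f : V → ℕ) : Set V := ⋃ t ∈ R.S v, R.Vf v f t

/-- `f` is a blocking flow in `I(e)`, `e = (par v, v)`: a feasible flow such that
`{V_f(t) : t ∈ T_e}` is a cut-system of `T_e` (pairwise disjoint `t`-sets avoiding the
terminal `u = par v`) each member of which is blocked by `f`, i.e.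
`f(e_t) = f(V_f(t)) = c(V_f(t)) − |odd(V_f(t))|`. -/
def IsBlocking (v : V) (f : V → ℕ) : Prop :=
  R.IsFlow v f ∧ R.Feasible v f ∧
  (∀ t ∈ R.Te v, R.par v ∉ R.Vf v f t) ∧
  (∀ t ∈ R.Te v, ∀ t' ∈ R.Te v, t ≠ t' → R.Vf v f t ∩ R.Vf v f t' = ∅) ∧
  (∀ t ∈ R.Te v, f t = R.hval v (R.Vf v f t) f ∧
    R.hval v (R.Vf v f t) f + (R.oddOf v (R.UT v f) (R.Vf v f t)).ncard
      = R.hval v (R.Vf v f t) R.c)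

/-- `Ψ(e)`: the set of values `f(e)` of blocking flows `f` of `I(e)`, `e = (par v, v)`. -/
def Psi (v : V) : Set ℕ := {x | ∃ f, R.IsBlocking v f ∧ f v = x}

/-- `a(e)`: the least element of `Ψ(e)`. -/
noncomputable def aE (v : V) : ℕ := sInf (R.Psi v)

/-- `b(e)`: the greatest element of `Ψ(e)`. -/
noncomputable def bE (v : V) : ℕ := sSup (R.Psi v)

/-- The edge `(par x, x)` is dominating: `b(e') + 2 ≤ a(e)` for its sibling edge `e'`. -/
def Dominating (x : V) : Prop :=
  x ≠ R.root ∧ ∃ y, y ≠ R.root ∧ y ≠ x ∧ R.par y = R.par x ∧ R.bE y + 2 ≤ R.aE x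

/-- The path from `v` down to `t` consists of dominating edges. -/
def DomPath (v t : V) : Prop :=
  R.below v t ∧ ∀ x, R.below v x → R.below x t → x ≠ v → R.Dominating x

/-- Condition (a) for the edge `e = (par v, v)`. -/
def CondA (v : V) : Prop :=
  (∃ a b, R.Psi v = Iv a b) ∧
  (R.leaf v → R.Psi v = {R.c v}) ∧
  (∀ w₁ w₂, w₁ ≠ w₂ → R.children v = {w₁, w₂} →
    R.Psi v = (otimes (R.Psi w₁) (R.Psi w₂) ∩ Set.Iic (R.c v)) ∪ {R.c v})

/-- Condition (b) for the edge `e = (u,v)`: if `e` has a dominating child-edge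
`e' = (v,w)`, then there is a terminal `t ∈ T_{e'}` with `g(u,t) ≥ a(e)` for every
decomposition `g` of every blocking flow of `I(e)`, and `P_{v,t}` a dominating path. -/
def CondB (v : V) : Prop :=
  ∀ w ∈ R.children v, R.Dominating w →
    ∃ t ∈ R.Te w, R.DomPath v t ∧
      ∀ f g, R.IsBlocking v f → R.IsDecomp v f g → R.aE v ≤ g s(R.par v, t)

/-- `γ(𝒳)` for the cut-system `𝒳 = {V_f(t) : t ∈ T_e ∪ {u}}`. -/
noncomputable def gammaX (v : V) (f : V → ℕ) : ℕ :=
  ∑ᶠ t ∈ R.S v, R.hval v (R.Vf v f t) R.c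

/-- `κ(𝒳)` for the cut-system `𝒳 = {V_f(t) : t ∈ T_e ∪ {u}}`: the number of
components of `G_e − ∪𝒳` of odd capacity. -/
noncomputable def kappaX (v : V) (f : V → ℕ) : ℕ :=
  {W : Set V | R.IsComp v (R.Ve v \ R.USall v f) W ∧ Odd (R.hval v W R.c)}.ncard

end RTI

namespace RTI

variable {V : Type*} {R : RTI V}

theorem below.trans {a b c : V} (h₁ : R.below a b) (h₂ : R.below b c) : R.below a c :=
  Relation.ReflTransGen.trans h₁ h₂

theorem below_refl (a : V) : R.below a a := Relation.ReflTransGen.refl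

theorem below_par_self {y : V} (hy : y ≠ R.root) : R.below (R.par y) y :=
  Relation.ReflTransGen.single ⟨rfl, hy⟩

theorem below.dep_le {a b : V} (h : R.below a b) : R.dep a ≤ R.dep b := by
  induction h with
  | refl => exact le_rfl
  | tail _ h ih =>
    have := R.dep_par _ h.2
    rw [h.1] at this
    omega

theorem below.eq_or_below_par {a b : V} (h : R.below a b) :
    a = b ∨ (R.below a (R.par b) ∧ b ≠ R.root) := by
  rcases Relation.ReflTransGen.cases_tail h with h | ⟨c, h, rfl, hb⟩
  · exact Or.inl h.symm
  · exact Or.inr ⟨h, hb⟩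

theorem not_below_par {x : V} (hx : x ≠ R.root) : ¬ R.below x (R.par x) := fun h => by
  have := h.dep_le
  have := R.dep_par x hx
  omega

theorem below.antisymm {a b : V} (h₁ : R.below a b) (h₂ : R.below b a) : a = b := by
  rcases h₁.eq_or_below_par with h | ⟨h, hb⟩
  · exact h
  · exact absurd (h₂.trans h) (not_below_par hb)

theorem below.total {a b c : V} (h₁ : R.below a c) (h₂ : R.below b c) :
    R.below a b ∨ R.below b a := by
  induction h₁ with
  | refl => exact Or.inr h₂
  | tail h h' ih =>
    rcases h₂.eq_or_below_par with rfl | ⟨h₃, -⟩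
    · exact Or.inl (h.tail h')
    · exact ih (h'.1 ▸ h₃)

theorem below.ne_root {a b : V} (h : R.below a b) (ha : a ≠ R.root) : b ≠ R.root := by
  rintro rfl
  have := h.dep_le
  have := R.dep_par a ha
  have := R.dep_root
  omega

theorem ne_root_of_below_par {x y : V} (hx : x ≠ R.root) (h : R.below x (R.par y)) :
    y ≠ R.root := by
  rintro rfl
  exact h.ne_root hx R.par_root

theorem below_of_below_par {x y : V} (hx : x ≠ R.root) (h : R.below x (R.par y)) :
    R.below x y :=
  h.trans (below_par_self (ne_root_of_below_par hx h))

theorem Te_subset {v x : V} (hvx : R.below v x) : R.Te x ⊆ R.Te v :=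
  fun _ ht => ⟨hvx.trans ht.1, ht.2⟩

/-- Two instances below a common edge agree on cut edges of vertex sets inside the smaller one. -/
theorem cutE_eq {v x : V} (hx : x ≠ R.root) (hvx : R.below v x) {X : Set V}
    (hX : ∀ w ∈ X, R.below x w) : R.cutE x X = R.cutE v X := by
  ext y
  refine ⟨fun h => ⟨hvx.trans h.1, h.2⟩, fun h => ⟨?_, h.2⟩⟩
  by_cases hy : y ∈ X
  · exact hX y hy
  · refine below_of_below_par hx (hX _ ?_)
    by_contra h'
    exact h.2 (by tauto)

theorem hval_eq {v x : V} (hx : x ≠ R.root) (hvx : R.below v x) {X : Set V}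
    (hX : ∀ w ∈ X, R.below x w) (h : V → ℕ) : R.hval x X h = R.hval v X h := by
  unfold hval
  rw [cutE_eq hx hvx hX]

theorem ConnSet.below_of_par_notMem {W : Set V} (hW : R.ConnSet W) {y : V} (hy : y ∈ W)
    (hyr : y ≠ R.root) (hpy : R.par y ∉ W) : ∀ w ∈ W, R.below y w := by
  intro w hw
  by_contra hyw
  refine hpy (hW y hy w hw _ ⟨Or.inl (below_par_self hyr), fun z hz hzw => ?_⟩)
  rcases hz.eq_or_below_par with rfl | h
  · exact absurd hzw hyw
  · exact h.1

/-- No vertex of `V_f(t)` lies outside the subtree of a saturated edge above `t`. -/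
theorem below_of_mem_Vf {v x t w : V} {f : V → ℕ} (hfx : f x = R.c x) (hxt : R.below x t)
    (hw : w ∈ R.Vf v f t) : R.below x w := by
  obtain ⟨-, z, -, hzt, hzw, hup, -⟩ := hw
  by_cases hxz : R.below x z
  · exact hxz.trans hzw
  · have hzx : R.below z x := (hzt.total hxt).resolve_right hxz
    have := hup x hzx hxt (fun h => hxz (h ▸ below_refl x))
    omega

/-- `V_f(t)` does not enter the subtree of a saturated edge from outside. -/
theorem not_below_of_mem_Vf {v x t w : V} {f : V → ℕ} (hfx : f x = R.c x)
    (hxt : ¬ R.below x t) (hw : w ∈ R.Vf v f t) : ¬ R.below x w := by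
  obtain ⟨-, z, -, hzt, hzw, -, hdown⟩ := hw
  intro hxw
  have hxz : ¬ R.below x z := fun h => hxt (h.trans hzt)
  have hzx : R.below z x := (hzw.total hxw).resolve_right hxz
  have := hdown x hzx hxw (fun h => hxz (h ▸ below_refl x))
  omega

theorem Vf_eq {v x t : V} {f : V → ℕ} (hvx : R.below v x)
    (hfx : f x = R.c x) (hxt : R.below x t) : R.Vf x f t = R.Vf v f t := by
  have key : ∀ z, R.below z t →
      (∀ y, R.below z y → R.below y t → y ≠ z → f y + 1 ≤ R.c y) → R.below x z := by
    intro z hzt hup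
    by_contra hxz
    have hzx : R.below z x := (hzt.total hxt).resolve_right hxz
    have := hup x hzx hxt (fun h => hxz (h ▸ below_refl x))
    omega
  ext w
  constructor
  · rintro ⟨-, z, -, hzt, hzw, hup, hdown⟩
    have hvz := hvx.trans (key z hzt hup)
    exact ⟨Or.inr (hvz.trans hzw), z, Or.inr hvz, hzt, hzw, hup, hdown⟩
  · rintro ⟨-, z, -, hzt, hzw, hup, hdown⟩
    have hxz := key z hzt hup
    exact ⟨Or.inr (hxz.trans hzw), z, Or.inr hxz, hzt, hzw, hup, hdown⟩

theorem mem_UT_iff {v x w : V} {f : V → ℕ} (hvx : R.below v x)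
    (hfx : f x = R.c x) (hxw : R.below x w) : w ∈ R.UT x f ↔ w ∈ R.UT v f := by
  simp only [UT, Set.mem_iUnion, exists_prop]
  constructor
  · rintro ⟨t, ht, hw⟩
    exact ⟨t, Te_subset hvx ht, Vf_eq hvx hfx ht.1 ▸ hw⟩
  · rintro ⟨t, ht, hw⟩
    have hxt : R.below x t := by
      by_contra hxt
      exact not_below_of_mem_Vf hfx hxt hw hxw
    exact ⟨t, ⟨hxt, ht.2⟩, (Vf_eq hvx hfx hxt).symm ▸ hw⟩

theorem mem_Ve_sdiff_UT_iff {v x w : V} {f : V → ℕ} (hvx : R.below v x)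
    (hfx : f x = R.c x) (hxw : R.below x w) :
    w ∈ R.Ve x \ R.UT x f ↔ w ∈ R.Ve v \ R.UT v f := by
  have h₁ : w ∈ R.Ve x := Or.inr hxw
  have h₂ : w ∈ R.Ve v := Or.inr (hvx.trans hxw)
  simp [h₁, h₂, mem_UT_iff hvx hfx hxw]

/-- Being a component only depends on the ambient set near the component. -/
theorem isComp_iff {v x y : V} (hx : x ≠ R.root) (hvx : R.below v x) (hxy : R.below x (R.par y))
    {A B W : Set V} (hAB : ∀ w, R.below x w → (w ∈ A ↔ w ∈ B)) (hW : ∀ w ∈ W, R.below y w) :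
    R.IsComp x A W ↔ R.IsComp v B W := by
  have hyx : R.below x y := below_of_below_par hx hxy
  have hWx : ∀ w ∈ W, R.below x w := fun w hw => hyx.trans (hW w hw)
  have hWp : ∀ w ∈ W, R.below x (R.par w) := fun w hw => by
    rcases (hW w hw).eq_or_below_par with rfl | h
    · exact hxy
    · exact hyx.trans h.1
  unfold IsComp
  refine and_congr_right fun _ => and_congr ?_ (and_congr_right fun _ => and_congr ?_ ?_)
  · exact ⟨fun h w hw => (hAB w (hWx w hw)).1 (h hw), fun h w hw => (hAB w (hWx w hw)).2 (h hw)⟩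
  · exact ⟨fun h w _ hw hA => h w (hWx w hw) hw ((hAB _ (hWp w hw)).2 hA),
      fun h w _ hw hA => h w (hvx.trans (hWx w hw)) hw ((hAB _ (hWp w hw)).1 hA)⟩
  · refine ⟨fun h w _ hw hA => ?_, fun h w hxw hw hA => h w (hvx.trans hxw) hw ((hAB _ hxw).1 hA)⟩
    have hxw := below_of_below_par hx (hWx _ hw)
    exact h w hxw hw ((hAB _ hxw).2 hA)

theorem oddOf_eq {v x : V} {f : V → ℕ} (hx : x ≠ R.root) (hvx : R.below v x)
    (hfx : f x = R.c x) {X : Set V} (hX : ∀ w ∈ X, R.below x w) :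
    R.oddOf x (R.UT x f) X = R.oddOf v (R.UT v f) X := by
  ext W
  simp only [oddOf, Set.mem_ofPred_eq]
  constructor
  · rintro ⟨hW, hodd, y, hy, hpW, hpX⟩
    have hxy := hX _ hpX
    have hWy := hW.2.2.1.below_of_par_notMem hy (ne_root_of_below_par hx hxy) hpW
    refine ⟨(isComp_iff hx hvx hxy (fun w => mem_Ve_sdiff_UT_iff hvx hfx) hWy).1 hW, ?_,
      y, hy, hpW, hpX⟩
    rwa [← hval_eq hx hvx fun w hw => (below_of_below_par hx hxy).trans (hWy w hw)]
  · rintro ⟨hW, hodd, y, hy, hpW, hpX⟩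
    have hxy := hX _ hpX
    have hWy := hW.2.2.1.below_of_par_notMem hy (ne_root_of_below_par hx hxy) hpW
    refine ⟨(isComp_iff hx hvx hxy (fun w => mem_Ve_sdiff_UT_iff hvx hfx) hWy).2 hW, ?_,
      y, hy, hpW, hpX⟩
    rwa [hval_eq hx hvx fun w hw => (below_of_below_par hx hxy).trans (hWy w hw)]

/-- The map contracting everything outside the subtree at `x` to `par x`. -/
noncomputable def contract (R : RTI V) (x t : V) : V := if R.below x t then t else R.par x

theorem below_contract_iff {x w : V} (hx : x ≠ R.root) (hxw : R.below x w) (t : V) :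
    R.below w (R.contract x t) ↔ R.below w t := by
  unfold contract
  split_ifs with h
  · rfl
  · exact iff_of_false (fun h' => not_below_par hx (hxw.trans h')) (fun h' => h (hxw.trans h'))

theorem onPath_contract_iff {x w : V} (hx : x ≠ R.root) (hxw : R.below x w) (t t' : V) :
    R.onPath w (R.contract x t) (R.contract x t') ↔ R.onPath w t t' := by
  simp only [onPath, below_contract_iff hx hxw]

theorem contract_mem_S {v x t : V} (hv : v ≠ R.root) (hvx : R.below v x) (ht : t ∈ R.S v) :
    R.contract x t ∈ R.S x := by
  unfold contract
  split_ifs with h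
  · rcases ht with rfl | ht
    · exact absurd (hvx.trans h) (not_below_par hv)
    · exact Or.inr ⟨h, ht.2⟩
  · exact Or.inl rfl

theorem exists_onPath_mk_iff (w a b : V) :
    (∃ t t', s(a, b) = s(t, t') ∧ R.onPath w t t') ↔ R.onPath w a b := by
  constructor
  · rintro ⟨t, t', h, hp⟩
    rcases Sym2.eq_iff.1 h with ⟨rfl, rfl⟩ | ⟨rfl, rfl⟩
    · exact hp
    · unfold onPath at *
      tauto
  · exact fun h => ⟨a, b, rfl, h⟩

theorem IsFlow.restrict [Finite V] {v x : V} {f : V → ℕ} (hv : v ≠ R.root) (hvx : R.below v x)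
    (hf : R.IsFlow v f) : R.IsFlow x f := by
  have := Fintype.ofFinite V
  have hx := hvx.ne_root hv
  obtain ⟨g, hg, hfg⟩ := hf
  refine ⟨fun p => if p.IsDiag then 0 else
    ∑ q : Sym2 V, if q.map (R.contract x) = p then g q else 0, fun p hp => ?_, fun w hw => ?_⟩
  · simp only [ne_eq, ite_eq_left_iff, not_forall] at hp
    obtain ⟨hd, hp⟩ := hp
    obtain ⟨q, -, hq⟩ := Finset.exists_ne_zero_of_sum_ne_zero hp
    obtain ⟨hqp, hgq⟩ := ite_ne_right_iff.1 hq
    subst hqp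
    obtain ⟨t, t', ht, ht', -, rfl⟩ := hg q hgq
    exact ⟨_, _, contract_mem_S hv hvx ht, contract_mem_S hv hvx ht',
      by simpa using hd, by simp⟩
  · rw [hfg w (hvx.trans hw), finsum_mem_def, finsum_mem_def, finsum_eq_sum_of_fintype,
      finsum_eq_sum_of_fintype]
    simp only [Set.indicator_apply, Set.mem_ofPred_eq]
    set P : Sym2 V → Prop := fun p => ∃ t t', p = s(t, t') ∧ R.onPath w t t'
    have hPd : ∀ p, P p → ¬ p.IsDiag := by
      rintro _ ⟨t, t', rfl, h⟩ hd
      rw [Sym2.mk_isDiag_iff] at hd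
      subst hd
      unfold onPath at h
      tauto
    have hPc : ∀ q : Sym2 V, P (q.map (R.contract x)) ↔ P q := by
      intro q
      induction q with
      | _ a b =>
        rw [Sym2.map_mk]
        exact (exists_onPath_mk_iff w _ _).trans
          ((onPath_contract_iff hx hw a b).trans (exists_onPath_mk_iff w a b).symm)
    calc ∑ q, (if P q then g q else 0)
        = ∑ q, ∑ p, (if q.map (R.contract x) = p then (if P p then g q else 0) else 0) := by
          refine Finset.sum_congr rfl fun q _ => ?_
          rw [Finset.sum_ite_eq]
          simp [hPc]
      _ = ∑ p, ∑ q, (if q.map (R.contract x) = p then (if P p then g q else 0) else 0) :=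
          Finset.sum_comm
      _ = ∑ p, if P p then (if p.IsDiag then 0 else
            ∑ q : Sym2 V, if q.map (R.contract x) = p then g q else 0) else 0 := by
          refine Finset.sum_congr rfl fun p _ => ?_
          by_cases hp : P p
          · simp only [hp, hPd p hp, if_true, if_false]
          · simp only [hp, if_false, ite_self, Finset.sum_const_zero]

/-- A blocking flow stays blocking in the instance of any edge it saturates. -/
theorem IsBlocking.restrict [Finite V] {v x : V} {f : V → ℕ} (hv : v ≠ R.root)
    (hf : R.IsBlocking v f) (hvx : R.below v x) (hfx : f x = R.c x) : R.IsBlocking x f := by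
  have hx := hvx.ne_root hv
  obtain ⟨hflow, hfeas, -, hdisj, hblock⟩ := hf
  refine ⟨hflow.restrict hv hvx, fun w hw => hfeas w (hvx.trans hw), fun t ht hp => ?_,
    fun t ht t' ht' hne => ?_, fun t ht => ?_⟩
  · exact not_below_par hx (below_of_mem_Vf hfx ht.1 hp)
  · rw [Vf_eq hvx hfx ht.1, Vf_eq hvx hfx ht'.1]
    exact hdisj t (Te_subset hvx ht) t' (Te_subset hvx ht') hne
  · have hX : ∀ w ∈ R.Vf v f t, R.below x w := fun w hw => below_of_mem_Vf hfx ht.1 hw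
    rw [Vf_eq hvx hfx ht.1, hval_eq hx hvx hX, hval_eq hx hvx hX, oddOf_eq hx hvx hfx hX]
    exact hblock t (Te_subset hvx ht)

end RTI

/-- Lemma 1(iv): if `f` is a blocking flow in `I(e)`, then every edge
`e' ∈ E_e` saturated by `f` (`f(e') = c(e')`) satisfies `c(e') ∈ Ψ(e')`. -/
theorem RTI.saturated_mem_Psi {V : Type*} [Fintype V] [DecidableEq V]
    (R : RTI V) (v : V) (hv : v ≠ R.root)
    (f : V → ℕ) (hf : R.IsBlocking v f) :
    ∀ x, R.below v x → f x = R.c x → R.c x ∈ R.Psi x := by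
  intro x hvx hfx
  exact ⟨f, hf.restrict hv hvx hfx, hfx⟩
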